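/- arXiv:2601.08730 — 3 statements merged into one kernel-verified Lean document; each statement's English description precedes it below -/
import Mathlib

section
/- (Gamma hedging with a moving implied volatility.) Let T > 0 and let π = (π_N) be a sequence of partitions of [0,T] with mesh tending to 0. Let X : [0,T] → ℝ be a continuous path with vanishing p₂-th variation along π and let σ : [0,T] → (0,∞) be a continuous path with vanishing p₁-th variation along π, where 1 ≤ p₁ ≤ 2, 1 ≤ p₂ ≤ 3 and 1/p₁ + 1/p₂ ≥ 1. For i = 0,…,n let F^i : [0,T] × (0,∞) × ℝ → ℝ be three times continuously differentiable on a neighbourhood of the path {(t, σ_t, X_t) : t ∈ [0,T]} and satisfy along the path both the Black–Scholes PDE ∂F^i/∂t (t,σ,s) + (1/2) σ² s² ∂²F^i/∂s² (t,σ,s) = 0 and the vega–gamma relation σ (T − t) s² ∂²F^i/∂s² (t,σ,s) = ∂F^i/∂σ (t,σ,s) at (t,σ,s) = (t, σ_t, X_t) for all t ∈ [0,T). Let q^i : [0,T] → ℝ be bounded with q^0 ≡ −1 and suppose for all t ∈ [0,T): Σ_{i=0}^n q^i_t ∂F^i/∂s (t, σ_t, X_t) = 0 and Σ_{i=0}^n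 q^i_t ∂²F^i/∂s² (t, σ_t, X_t) = 0. Then F^0(T, σ_T, X_T) = F^0(0, σ_0, X_0) + lim_{N→∞} Σ_{[u,v]∈π_N} Σ_{i=1}^n q^i_u ( F^i(v, σ_v, X_v) − F^i(u, σ_u, X_u) ). -/
open Filter Topology

/-- A sequence of partitions of `[0, T]` with mesh tending to zero.
For each `N`, the partition `π_N` has points `t N 0 = 0 < t N 1 < ⋯ < t N (c N) = T`. -/
structure PartitionSeq (T : ℝ) : Type where
  c : ℕ → ℕ
  t : ℕ → ℕ → ℝ
  c_pos : ∀ N, 0 < c N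
  first : ∀ N, t N 0 = 0
  last : ∀ N, t N (c N) = T
  mono : ∀ N, ∀ i < c N, t N i < t N (i + 1)
  mesh_to_zero : ∀ ε > 0, ∃ M : ℕ, ∀ N ≥ M, ∀ i < c N, t N (i + 1) - t N i < ε

/-- A path `X` has vanishing `p`-th variation along the partition sequence `π` if
`Σ_{[u,v] ∈ π_N} ‖X_v - X_u‖^p → 0` as `N → ∞`. -/
def VanishingVariation {V : Type*} [NormedAddCommGroup V] {T : ℝ}
    (π : PartitionSeq T) (p : ℝ) (X : ℝ → V) : Prop :=
  Tendsto (fun N => ∑ i ∈ Finset.range (π.c N),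
    ‖X (π.t N (i + 1)) - X (π.t N i)‖ ^ p) atTop (nhds 0)

/-- Near a compact set, the increments of a `C²` function are given by its differential at a nearby
point of the compact set, up to a uniform second-order error. -/
theorem IsCompact.exists_norm_sub_sub_fderiv_le {E G : Type*}
    [NormedAddCommGroup E] [NormedSpace ℝ E] [ProperSpace E]
    [NormedAddCommGroup G] [NormedSpace ℝ G]
    {K U : Set E} (hK : IsCompact K) (hU : IsOpen U) (hKU : K ⊆ U)
    {f : E → G} (hf : ContDiffOn ℝ 2 f U) :
    ∃ δ > 0, ∃ M : ℝ, 0 ≤ M ∧ ∀ z ∈ K, ∀ r < δ, ∀ x ∈ Metric.closedBall z r,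
      ∀ y ∈ Metric.closedBall z r,
        x ∈ U ∧ ‖f y - f x - fderiv ℝ f z (y - x)‖ ≤ M * r * ‖y - x‖ := by
  obtain ⟨δ, hδ, hδU⟩ := hK.exists_cthickening_subset_open hU hKU
  have hf' : ContDiffOn ℝ 1 (fderiv ℝ f) U := hf.fderiv_of_isOpen hU (by norm_num)
  have hf'' : ContinuousOn (fderiv ℝ (fderiv ℝ f)) U :=
    hf'.continuousOn_fderiv_of_isOpen hU le_rfl
  obtain ⟨M, hM⟩ := hK.cthickening.exists_bound_of_continuousOn (E := E →L[ℝ] E →L[ℝ] G)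
    (hf''.mono hδU)
  refine ⟨δ, hδ, max M 0, le_max_right _ _, fun z hz r hr x hx y hy => ?_⟩
  have hball : Metric.closedBall z r ⊆ Metric.cthickening δ K :=
    (Metric.closedBall_subset_closedBall hr.le).trans (Metric.closedBall_subset_cthickening hz δ)
  have hr0 : 0 ≤ r := dist_nonneg.trans (Metric.mem_closedBall.1 hx)
  have hzr : z ∈ Metric.closedBall z r := Metric.mem_closedBall_self hr0
  refine ⟨hδU (hball hx), ?_⟩
  refine (convex_closedBall z r).norm_image_sub_le_of_norm_hasFDerivWithin_le'
    (f' := fderiv ℝ f) (fun w hw => ?_) (fun w hw => ?_) hx hy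
  · exact ((hf.differentiableOn (by norm_num)).differentiableAt
      (hU.mem_nhds (hδU (hball hw)))).hasFDerivAt.hasFDerivWithinAt
  · refine ((convex_closedBall z r).norm_image_sub_le_of_norm_fderiv_le (𝕜 := ℝ)
      (fun v hv => (hf'.differentiableOn one_ne_zero).differentiableAt
        (hU.mem_nhds (hδU (hball hv))))
      (fun v hv => (hM v (hball hv)).trans (le_max_left M 0)) hzr hw).trans ?_
    gcongr
    exact mem_closedBall_iff_norm.1 hw

/-- Uniform Taylor estimate near a compact set, of second order in the last variable and of first
order in the first two. -/
theorem IsCompact.exists_abs_taylor_remainder_le {K U : Set (ℝ × ℝ × ℝ)} (hK : IsCompact K)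
    (hU : IsOpen U) (hKU : K ⊆ U) {f : ℝ × ℝ × ℝ → ℝ} (hf : ContDiffOn ℝ 3 f U) :
    ∃ δ > 0, ∃ C : ℝ, ∀ z ∈ K, ∀ z' : ℝ × ℝ × ℝ, ‖z' - z‖ < δ →
      |f z' - f z - fderiv ℝ f z (z' - z) -
          1 / 2 * fderiv ℝ (fun z => fderiv ℝ f z ((0 : ℝ), (0 : ℝ), (1 : ℝ))) z
            ((0 : ℝ), (0 : ℝ), (1 : ℝ)) * (z'.2.2 - z.2.2) ^ 2| ≤
        C * ((|z'.1 - z.1| + |z'.2.1 - z.2.1|) *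
          (|z'.1 - z.1| + |z'.2.1 - z.2.1| + |z'.2.2 - z.2.2|) + |z'.2.2 - z.2.2| ^ 3) := by
  set e : ℝ × ℝ × ℝ := ((0 : ℝ), (0 : ℝ), (1 : ℝ)) with he
  set g : ℝ × ℝ × ℝ → ℝ := fun z => fderiv ℝ f z e with hg_def
  have hg : ContDiffOn ℝ 2 g U :=
    (hf.fderiv_of_isOpen hU (by norm_num)).clm_apply contDiffOn_const
  obtain ⟨δ₁, hδ₁, M₁, hM₁, h₁⟩ :=
    hK.exists_norm_sub_sub_fderiv_le hU hKU (hf.of_le (by norm_num))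
  obtain ⟨δ₂, hδ₂, M₂, hM₂, h₂⟩ := hK.exists_norm_sub_sub_fderiv_le hU hKU hg
  refine ⟨min δ₁ δ₂, lt_min hδ₁ hδ₂, M₁ + M₂, ?_⟩
  rintro ⟨t, a, s⟩ hz ⟨t', a', s'⟩ hzz
  have hnorm : ‖((t', a', s') : ℝ × ℝ × ℝ) - (t, a, s)‖ =
      max |t' - t| (max |a' - a| |s' - s|) := by
    simp [Prod.norm_def]
  have hs : |s' - s| < min δ₁ δ₂ := by
    refine lt_of_le_of_lt ?_ hzz
    rw [hnorm]; simp
  have hline (x : ℝ) : ((t, a, x) : ℝ × ℝ × ℝ) - (t, a, s) = (x - s) • e := by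
    simp [he]
  have hmem (x : ℝ) (hx : x ∈ Metric.closedBall s |s' - s|) :
      ((t, a, x) : ℝ × ℝ × ℝ) ∈ Metric.closedBall ((t, a, s) : ℝ × ℝ × ℝ) |s' - s| := by
    rw [mem_closedBall_iff_norm] at hx ⊢
    rw [hline, norm_smul]
    simpa [he, Prod.norm_def] using hx
  have hself : ((t, a, s) : ℝ × ℝ × ℝ) ∈ Metric.closedBall ((t, a, s) : ℝ × ℝ × ℝ) |s' - s| :=
    Metric.mem_closedBall_self (abs_nonneg _)
  have hs' : s' ∈ Metric.closedBall s |s' - s| := by simp [Real.dist_eq]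
  have hlast : |f (t, a, s') - f (t, a, s) - (s' - s) * g (t, a, s) -
      1 / 2 * fderiv ℝ g (t, a, s) e * (s' - s) ^ 2| ≤ M₂ * |s' - s| ^ 3 := by
    have key := (convex_closedBall s |s' - s|).norm_image_sub_le_of_norm_hasDerivWithin_le
      (f := fun x => f (t, a, x) - (x - s) * g (t, a, s) -
        1 / 2 * fderiv ℝ g (t, a, s) e * (x - s) ^ 2)
      (f' := fun x => g (t, a, x) - g (t, a, s) - fderiv ℝ g (t, a, s) e * (x - s))
      (C := M₂ * |s' - s| * |s' - s|)
      (fun x hx => ?_) (fun x hx => ?_) (Metric.mem_closedBall_self (abs_nonneg _)) hs'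
    · simp only [Real.norm_eq_abs] at key
      convert key using 1
      · congr 1; ring
      · ring
    · have hd : HasFDerivAt f (fderiv ℝ f (t, a, x)) (t, a, x) :=
        ((hf.differentiableOn (by norm_num)).differentiableAt (hU.mem_nhds
          (h₂ _ hz _ (hs.trans_le (min_le_right _ _)) _ (hmem x hx) _ hself).1)).hasFDerivAt
      have hl : HasDerivAt (fun x : ℝ => ((t, a, x) : ℝ × ℝ × ℝ)) e x :=
        (hasDerivAt_const x t).prodMk ((hasDerivAt_const x a).prodMk (hasDerivAt_id x))
      have h1 := hd.comp_hasDerivAt x hl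
      have h2 : HasDerivAt (fun x : ℝ => x - s) 1 x := (hasDerivAt_id x).sub_const s
      have h3 := (h1.sub (h2.mul_const (g (t, a, s)))).sub
        ((h2.pow 2).const_mul (1 / 2 * fderiv ℝ g (t, a, s) e))
      refine (h3.congr_deriv ?_).hasDerivWithinAt
      push_cast
      ring
    · have h := (h₂ _ hz _ (hs.trans_le (min_le_right _ _)) _ hself _ (hmem x hx)).2
      rw [hline, map_smul, norm_smul, smul_eq_mul, mul_comm (x - s)] at h
      refine h.trans ?_
      have : ‖e‖ = 1 := by simp [he, Prod.norm_def]
      rw [this, mul_one]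
      gcongr
      exact mem_closedBall_iff_norm.1 hx
  have hfirst : |f (t', a', s') - f (t, a, s') - fderiv ℝ f (t, a, s) (t' - t, a' - a, 0)| ≤
      M₁ * (|t' - t| + |a' - a| + |s' - s|) * (|t' - t| + |a' - a|) := by
    have hmid : ((t, a, s') : ℝ × ℝ × ℝ) ∈ Metric.closedBall ((t, a, s) : ℝ × ℝ × ℝ)
        ‖((t', a', s') : ℝ × ℝ × ℝ) - (t, a, s)‖ :=
      Metric.closedBall_subset_closedBall (by rw [hnorm]; simp) (hmem s' hs')
    have h := (h₁ _ hz _ (hzz.trans_le (min_le_left _ _)) _ hmid (t', a', s')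
      (by rw [mem_closedBall_iff_norm])).2
    have hd : ((t', a', s') : ℝ × ℝ × ℝ) - (t, a, s') = (t' - t, a' - a, 0) := by simp
    rw [hd, hnorm] at h
    have h0 : ‖((t' - t, a' - a, 0) : ℝ × ℝ × ℝ)‖ ≤ |t' - t| + |a' - a| := by
      simp [Prod.norm_def]
    refine h.trans ?_
    have := abs_nonneg (t' - t)
    have := abs_nonneg (a' - a)
    have := abs_nonneg (s' - s)
    gcongr
    refine max_le (by linarith) (max_le (by linarith) (by linarith))
  have hsplit : fderiv ℝ f (t, a, s) ((t', a', s') - (t, a, s)) =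
      fderiv ℝ f (t, a, s) (t' - t, a' - a, 0) + (s' - s) * g (t, a, s) := by
    rw [hg_def, ← smul_eq_mul, ← map_smul, ← map_add]
    simp [he]
  rw [hsplit]
  calc _ = |(f (t', a', s') - f (t, a, s') - fderiv ℝ f (t, a, s) (t' - t, a' - a, 0)) +
        (f (t, a, s') - f (t, a, s) - (s' - s) * g (t, a, s) -
          1 / 2 * fderiv ℝ g (t, a, s) e * (s' - s) ^ 2)| := by congr 1; ring
    _ ≤ _ := (abs_add_le _ _).trans (add_le_add hfirst hlast)
    _ ≤ _ := by
      have h1 : 0 ≤ M₂ * ((|t' - t| + |a' - a|) * (|t' - t| + |a' - a| + |s' - s|)) := by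
        positivity
      have h2 : 0 ≤ M₁ * |s' - s| ^ 3 := by positivity
      linarith

theorem mul_le_rpow_add_rpow {p q x y : ℝ} (hp : 0 < p) (hq : 0 < q) (hpq : 1 ≤ 1 / p + 1 / q)
    (hx0 : 0 ≤ x) (hx1 : x ≤ 1) (hy0 : 0 ≤ y) (hy1 : y ≤ 1) : x * y ≤ x ^ p + y ^ q := by
  set m := max (x ^ p) (y ^ q)
  have hxp : 0 ≤ x ^ p := Real.rpow_nonneg hx0 p
  have hyq : 0 ≤ y ^ q := Real.rpow_nonneg hy0 q
  have hm0 : 0 ≤ m := hxp.trans (le_max_left _ _)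
  have hm1 : m ≤ 1 := max_le (Real.rpow_le_one hx0 hx1 hp.le) (Real.rpow_le_one hy0 hy1 hq.le)
  have hxm : x ≤ m ^ (1 / p) := by
    rw [one_div, Real.le_rpow_inv_iff_of_pos hx0 hm0 hp]
    exact le_max_left _ _
  have hym : y ≤ m ^ (1 / q) := by
    rw [one_div, Real.le_rpow_inv_iff_of_pos hy0 hm0 hq]
    exact le_max_right _ _
  calc x * y ≤ m ^ (1 / p) * m ^ (1 / q) := by gcongr
    _ = m ^ (1 / p + 1 / q) := (Real.rpow_add_of_nonneg hm0 (by positivity) (by positivity)).symm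
    _ ≤ m ^ (1 : ℝ) := Real.rpow_le_rpow_of_exponent_ge_of_imp hm0 hm1 hpq
      (fun _ h => absurd h (by positivity))
    _ = m := Real.rpow_one m
    _ ≤ _ := max_le_add_of_nonneg hxp hyq

theorem pow_le_rpow_of_le_one {p x : ℝ} {k : ℕ} (hp : 0 < p) (hpk : p ≤ k) (hx0 : 0 ≤ x)
    (hx1 : x ≤ 1) : x ^ k ≤ x ^ p := by
  rw [← Real.rpow_natCast]
  exact Real.rpow_le_rpow_of_exponent_ge_of_imp hx0 hx1 hpk (fun _ h => absurd h (hp.trans_le hpk).ne')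

namespace PartitionSeq

variable {T : ℝ} (π : PartitionSeq T)

theorem mem_Icc {N k : ℕ} (hk : k ≤ π.c N) : π.t N k ∈ Set.Icc 0 T := by
  have hmono : MonotoneOn (π.t N) (Set.Iic (π.c N)) :=
    monotoneOn_of_le_succ Set.ordConnected_Iic fun a _ _ ha =>
      (π.mono N a (Nat.lt_of_succ_le ha)).le
  exact ⟨(π.first N).symm.trans_le (hmono (Nat.zero_le _) hk (Nat.zero_le _)),
    (hmono hk (Set.mem_Iic.2 le_rfl) hk).trans_eq (π.last N)⟩

theorem mem_Ico {N k : ℕ} (hk : k < π.c N) : π.t N k ∈ Set.Ico 0 T :=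
  ⟨(π.mem_Icc hk.le).1, (π.mono N k hk).trans_le (π.mem_Icc hk).2⟩

theorem eventually_norm_sub_lt {V : Type*} [NormedAddCommGroup V] {Z : ℝ → V}
    (hZ : ContinuousOn Z (Set.Icc 0 T)) {ε : ℝ} (hε : 0 < ε) :
    ∀ᶠ N in atTop, ∀ k < π.c N, ‖Z (π.t N (k + 1)) - Z (π.t N k)‖ < ε := by
  obtain ⟨δ, hδ, h⟩ := Metric.uniformContinuousOn_iff.1
    (isCompact_Icc.uniformContinuousOn_of_continuous hZ) ε hε
  obtain ⟨M, hM⟩ := π.mesh_to_zero δ hδ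
  filter_upwards [eventually_ge_atTop M] with N hN k hk
  rw [← dist_eq_norm]
  refine h _ (π.mem_Icc hk) _ (π.mem_Icc hk.le) ?_
  rw [Real.dist_eq, abs_of_pos (sub_pos.2 (π.mono N k hk))]
  exact hM N hN k hk

/-- The error terms of the Taylor expansion along a path with components of vanishing `p`-th and
`q`-th variation sum up to a null sequence. -/
theorem tendsto_sum_taylor_error (hT : 0 ≤ T) {p q : ℝ} (hp : 1 ≤ p) (hp' : p ≤ 2) (hq : 1 ≤ q)
    (hq' : q ≤ 3) (hpq : 1 ≤ 1 / p + 1 / q) {Y X : ℝ → ℝ}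
    (hYc : ContinuousOn Y (Set.Icc 0 T)) (hXc : ContinuousOn X (Set.Icc 0 T))
    (hY : VanishingVariation π p Y) (hX : VanishingVariation π q X) :
    Tendsto (fun N => ∑ k ∈ Finset.range (π.c N),
      ((|π.t N (k + 1) - π.t N k| + |Y (π.t N (k + 1)) - Y (π.t N k)|) *
        (|π.t N (k + 1) - π.t N k| + |Y (π.t N (k + 1)) - Y (π.t N k)| +
          |X (π.t N (k + 1)) - X (π.t N k)|) + |X (π.t N (k + 1)) - X (π.t N k)| ^ 3))
      atTop (𝓝 0) := by
  have hlim := (hY.const_mul 2).add (hX.const_mul 2)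
  simp only [mul_zero, add_zero] at hlim
  refine tendsto_order.2 ⟨fun b hb => Eventually.of_forall fun N => hb.trans_le
    (Finset.sum_nonneg fun k _ => by positivity), fun b hb => ?_⟩
  set ε := min 1 (b / (2 * (4 * T + 1)))
  have hε : 0 < ε := lt_min one_pos (by positivity)
  have hε1 : ε ≤ 1 := min_le_left _ _
  have hεT : 4 * ε * T ≤ b / 2 := by
    have h : ε * (2 * (4 * T + 1)) ≤ b := (le_div_iff₀ (by positivity)).1 (min_le_right _ _)
    linarith
  filter_upwards [π.eventually_norm_sub_lt continuousOn_id hε, π.eventually_norm_sub_lt hYc hε,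
    π.eventually_norm_sub_lt hXc hε, hlim.eventually_lt_const (half_pos hb)] with N ht hy hx hN
  refine (Finset.sum_le_sum (g := fun k => 4 * ε * (π.t N (k + 1) - π.t N k) +
    (2 * ‖Y (π.t N (k + 1)) - Y (π.t N k)‖ ^ p + 2 * ‖X (π.t N (k + 1)) - X (π.t N k)‖ ^ q))
    fun k hk => ?_).trans_lt ?_
  · rw [Finset.mem_range] at hk
    have htk := (ht k hk).le
    have hyk := (hy k hk).le
    have hxk := (hx k hk).le
    have hτ := sub_pos.2 (π.mono N k hk)
    simp only [id, Real.norm_eq_abs] at htk hyk hxk ⊢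
    rw [abs_of_pos hτ] at htk ⊢
    set τ := π.t N (k + 1) - π.t N k
    set y := |Y (π.t N (k + 1)) - Y (π.t N k)|
    set x := |X (π.t N (k + 1)) - X (π.t N k)|
    have hy0 : 0 ≤ y := abs_nonneg _
    have hx0 : 0 ≤ x := abs_nonneg _
    have h1 : τ * τ ≤ τ * ε := by gcongr
    have h2 : τ * y ≤ τ * ε := by gcongr
    have h3 : τ * x ≤ τ * ε := by gcongr
    have h4 : y * x ≤ y ^ p + x ^ q := mul_le_rpow_add_rpow (by linarith) (by linarith) hpq hy0
      (hyk.trans hε1) hx0 (hxk.trans hε1)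
    have h5 : y ^ 2 ≤ y ^ p := pow_le_rpow_of_le_one (by linarith) (by exact_mod_cast hp') hy0
      (hyk.trans hε1)
    have h6 : x ^ 3 ≤ x ^ q := pow_le_rpow_of_le_one (by linarith) (by exact_mod_cast hq') hx0
      (hxk.trans hε1)
    linarith
  · rw [Finset.sum_add_distrib, Finset.sum_add_distrib, ← Finset.mul_sum, ← Finset.mul_sum,
      ← Finset.mul_sum, Finset.sum_range_sub, π.last, π.first, sub_zero]
    linarith

end PartitionSeq

/-- Corollary: pathwise convergence of gamma hedging in the Black–Scholes model with a
moving implied volatility. -/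
theorem gamma_hedging_moving_vol
    (T : ℝ) (hT : 0 < T) (π : PartitionSeq T)
    (p1 p2 : ℝ) (hp1 : 1 ≤ p1) (hp1' : p1 ≤ 2) (hp2 : 1 ≤ p2) (hp2' : p2 ≤ 3)
    (hp : 1 ≤ 1 / p1 + 1 / p2)
    (X : ℝ → ℝ) (hXc : ContinuousOn X (Set.Icc 0 T))
    (hX : VanishingVariation π p2 X)
    (σ : ℝ → ℝ) (hσc : ContinuousOn σ (Set.Icc 0 T))
    (hσpos : ∀ t ∈ Set.Icc (0 : ℝ) T, 0 < σ t)
    (hσ : VanishingVariation π p1 σ)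
    (n : ℕ) (F : ℕ → ℝ × ℝ × ℝ → ℝ) (q : ℕ → ℝ → ℝ)
    -- each `F i` is three times continuously differentiable on a neighbourhood of the path
    (U : Set (ℝ × ℝ × ℝ)) (hU : IsOpen U)
    (hpath : ∀ t ∈ Set.Icc (0 : ℝ) T, (t, σ t, X t) ∈ U)
    (hF : ∀ i ≤ n, ContDiffOn ℝ 3 (F i) U)
    -- the Black–Scholes PDE along the path
    (hBS : ∀ i ≤ n, ∀ t ∈ Set.Ico (0 : ℝ) T,
      fderiv ℝ (F i) (t, σ t, X t) ((1 : ℝ), (0 : ℝ), (0 : ℝ)) +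
        (1 / 2) * (σ t) ^ 2 * (X t) ^ 2 *
          fderiv ℝ (fun z => fderiv ℝ (F i) z ((0 : ℝ), (0 : ℝ), (1 : ℝ))) (t, σ t, X t)
            ((0 : ℝ), (0 : ℝ), (1 : ℝ)) = 0)
    -- the vega–gamma relation along the path
    (hVG : ∀ i ≤ n, ∀ t ∈ Set.Ico (0 : ℝ) T,
      σ t * (T - t) * (X t) ^ 2 *
          fderiv ℝ (fun z => fderiv ℝ (F i) z ((0 : ℝ), (0 : ℝ), (1 : ℝ))) (t, σ t, X t)
            ((0 : ℝ), (0 : ℝ), (1 : ℝ)) =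
        fderiv ℝ (F i) (t, σ t, X t) ((0 : ℝ), (1 : ℝ), (0 : ℝ)))
    -- the `q i` are bounded, with a unit short position in the target option
    (hq : ∀ i ≤ n, ∃ C : ℝ, ∀ t ∈ Set.Icc (0 : ℝ) T, |q i t| ≤ C)
    (hq0 : ∀ t, q 0 t = -1)
    -- delta neutrality
    (hdelta : ∀ t ∈ Set.Ico (0 : ℝ) T,
      ∑ i ∈ Finset.range (n + 1),
        q i t * fderiv ℝ (F i) (t, σ t, X t) ((0 : ℝ), (0 : ℝ), (1 : ℝ)) = 0)
    -- gamma neutrality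
    (hgamma : ∀ t ∈ Set.Ico (0 : ℝ) T,
      ∑ i ∈ Finset.range (n + 1),
        q i t * fderiv ℝ (fun z => fderiv ℝ (F i) z ((0 : ℝ), (0 : ℝ), (1 : ℝ))) (t, σ t, X t)
          ((0 : ℝ), (0 : ℝ), (1 : ℝ)) = 0) :
    Tendsto (fun N => ∑ k ∈ Finset.range (π.c N), ∑ i ∈ Finset.Icc 1 n,
        q i (π.t N k) *
          (F i (π.t N (k + 1), σ (π.t N (k + 1)), X (π.t N (k + 1))) -
            F i (π.t N k, σ (π.t N k), X (π.t N k))))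
      atTop (nhds (F 0 (T, σ T, X T) - F 0 (0, σ 0, X 0))) := by
  set Z : ℝ → ℝ × ℝ × ℝ := fun t => (t, σ t, X t) with hZ_def
  set Γ : ℕ → ℝ × ℝ × ℝ → ℝ := fun i z =>
    fderiv ℝ (fun z => fderiv ℝ (F i) z ((0 : ℝ), (0 : ℝ), (1 : ℝ))) z
      ((0 : ℝ), (0 : ℝ), (1 : ℝ)) with hΓ_def
  -- the Taylor remainder of `F i` between `u` and `v`
  set R : ℕ → ℝ → ℝ → ℝ := fun i u v =>
    F i (Z v) - F i (Z u) - fderiv ℝ (F i) (Z u) (Z v - Z u) -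
      1 / 2 * Γ i (Z u) * (X v - X u) ^ 2 with hR_def
  have hZc : ContinuousOn Z (Set.Icc 0 T) := continuousOn_id.prodMk (hσc.prodMk hXc)
  have hsum (i : ℕ) (hi : i ≤ n) : Tendsto (fun N => ∑ k ∈ Finset.range (π.c N),
      q i (π.t N k) * R i (π.t N k) (π.t N (k + 1))) atTop (𝓝 0) := by
    obtain ⟨δ, hδ, C, hC⟩ := (isCompact_Icc.image_of_continuousOn hZc).exists_abs_taylor_remainder_le
      hU (Set.image_subset_iff.2 hpath) (hF i hi)
    obtain ⟨B, hB⟩ := hq i hi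
    have hB0 : 0 ≤ B := (abs_nonneg _).trans (hB 0 ⟨le_rfl, hT.le⟩)
    have herr := (π.tendsto_sum_taylor_error hT.le hp1 hp1' hp2 hp2' hp hσc hXc hσ hX).const_mul
      (B * C)
    rw [mul_zero] at herr
    refine squeeze_zero_norm' ?_ herr
    filter_upwards [π.eventually_norm_sub_lt hZc hδ] with N hN
    rw [Finset.mul_sum]
    refine norm_sum_le_of_le _ fun k hk => ?_
    rw [Finset.mem_range] at hk
    rw [norm_mul, mul_assoc]
    exact mul_le_mul (hB _ (π.mem_Icc hk.le))
      (hC _ (Set.mem_image_of_mem Z (π.mem_Icc hk.le)) _ (hN k hk)) (norm_nonneg _) hB0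
  have hneutral (u v : ℝ) (hu : u ∈ Set.Ico 0 T) :
      ∑ i ∈ Finset.range (n + 1), q i u * (F i (Z v) - F i (Z u)) =
        ∑ i ∈ Finset.range (n + 1), q i u * R i u v := by
    have hterm : ∀ i ∈ Finset.range (n + 1), q i u * (F i (Z v) - F i (Z u)) =
        q i u * R i u v +
          (((σ v - σ u) * (σ u * (T - u) * X u ^ 2) - (v - u) * (1 / 2 * σ u ^ 2 * X u ^ 2) +
              1 / 2 * (X v - X u) ^ 2) * (q i u * Γ i (Z u)) +
            (X v - X u) * (q i u * fderiv ℝ (F i) (Z u) ((0 : ℝ), (0 : ℝ), (1 : ℝ)))) := by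
      intro i hi
      have hin : i ≤ n := Nat.lt_succ_iff.1 (Finset.mem_range.1 hi)
      have hdecomp : Z v - Z u = (v - u) • ((1 : ℝ), (0 : ℝ), (0 : ℝ)) +
          (σ v - σ u) • ((0 : ℝ), (1 : ℝ), (0 : ℝ)) +
          (X v - X u) • ((0 : ℝ), (0 : ℝ), (1 : ℝ)) := by
        simp [hZ_def]
      have hlin : fderiv ℝ (F i) (Z u) (Z v - Z u) =
          (v - u) * fderiv ℝ (F i) (Z u) ((1 : ℝ), (0 : ℝ), (0 : ℝ)) +
          (σ v - σ u) * fderiv ℝ (F i) (Z u) ((0 : ℝ), (1 : ℝ), (0 : ℝ)) +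
          (X v - X u) * fderiv ℝ (F i) (Z u) ((0 : ℝ), (0 : ℝ), (1 : ℝ)) := by
        rw [hdecomp]
        simp only [map_add, map_smul, smul_eq_mul]
      have htheta : fderiv ℝ (F i) (Z u) ((1 : ℝ), (0 : ℝ), (0 : ℝ)) =
          -(1 / 2 * σ u ^ 2 * X u ^ 2 * Γ i (Z u)) := eq_neg_of_add_eq_zero_left (hBS i hin u hu)
      have hvega : fderiv ℝ (F i) (Z u) ((0 : ℝ), (1 : ℝ), (0 : ℝ)) =
          σ u * (T - u) * X u ^ 2 * Γ i (Z u) := (hVG i hin u hu).symm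
      simp only [hR_def]
      rw [hlin, htheta, hvega]
      ring
    have hd : ∑ i ∈ Finset.range (n + 1),
        q i u * fderiv ℝ (F i) (Z u) ((0 : ℝ), (0 : ℝ), (1 : ℝ)) = 0 := hdelta u hu
    have hg : ∑ i ∈ Finset.range (n + 1), q i u * Γ i (Z u) = 0 := hgamma u hu
    rw [Finset.sum_congr rfl hterm, Finset.sum_add_distrib, Finset.sum_add_distrib,
      ← Finset.mul_sum, ← Finset.mul_sum, hd, hg]
    ring
  have htotal : Tendsto (fun N => ∑ i ∈ Finset.range (n + 1), ∑ k ∈ Finset.range (π.c N),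
      q i (π.t N k) * R i (π.t N k) (π.t N (k + 1))) atTop (𝓝 0) := by
    simpa using tendsto_finsetSum (Finset.range (n + 1))
      fun i hi => hsum i (Nat.lt_succ_iff.1 (Finset.mem_range.1 hi))
  have hlim := htotal.add_const (F 0 (Z T) - F 0 (Z 0))
  rw [zero_add] at hlim
  refine hlim.congr fun N => ?_
  have htele : ∑ k ∈ Finset.range (π.c N), (F 0 (Z (π.t N (k + 1))) - F 0 (Z (π.t N k))) =
      F 0 (Z T) - F 0 (Z 0) := by
    rw [Finset.sum_range_sub (fun k => F 0 (Z (π.t N k))), π.last, π.first]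
  rw [Finset.sum_comm, ← htele, ← Finset.sum_add_distrib]
  refine Finset.sum_congr rfl fun k hk => ?_
  rw [← hneutral _ _ (π.mem_Ico (Finset.mem_range.1 hk)), Finset.range_eq_Ico,
    Finset.sum_eq_sum_Ico_succ_bot n.succ_pos, hq0]
  have hIco : Finset.Ico (0 + 1) (n + 1) = Finset.Icc 1 n := by
    ext; simp
  rw [hIco]
  ring
end

section
/- Let T > 0 and let π = (π_N) be a sequence of partitions of [0,T] with mesh tending to 0. Let X : [0,T] → ℝ be a continuous path with quadratic variation [X] along π, and let Y : [0,T] → ℝ be continuous. Then lim_{N→∞} Σ_{[u,v]∈π_N} Y_u (X_v − X_u)² = ∫_{[0,T]} Y_s d[X]_s = lim_{N→∞} Σ_{[u,v]∈π_N} Y_u ([X]_v − [X]_u), where d[X] denotes the Lebesgue–Stieltjes measure of the nondecreasing continuous function [X]. -/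
open Filter Topology

open MeasureTheory

namespace PartitionSeq

variable {T : ℝ} (π : PartitionSeq T)

lemma t_le_t {N i j : ℕ} (hij : i ≤ j) (hj : j ≤ π.c N) : π.t N i ≤ π.t N j := by
  induction j, hij using Nat.le_induction with
  | base => exact le_rfl
  | succ j _ ih => exact (ih (by omega)).trans (π.mono N j (by omega)).le

lemma t_mem_Icc {N i : ℕ} (hi : i ≤ π.c N) : π.t N i ∈ Set.Icc 0 T := by
  exact ⟨(π.first N).symm.trans_le (π.t_le_t i.zero_le hi),
    (π.t_le_t hi le_rfl).trans_eq (π.last N)⟩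

lemma eventually_abs_sub_le {Y : ℝ → ℝ} (hY : ContinuousOn Y (Set.Icc 0 T)) {δ : ℝ} (hδ : 0 < δ) :
    ∀ᶠ N in atTop, ∀ i < π.c N, ∀ x ∈ Set.Icc (π.t N i) (π.t N (i + 1)),
      |Y x - Y (π.t N i)| ≤ δ := by
  obtain ⟨η, hη, h⟩ := Metric.uniformContinuousOn_iff.1
    (isCompact_Icc.uniformContinuousOn_of_continuous hY) δ hδ
  obtain ⟨M, hM⟩ := π.mesh_to_zero η hη
  filter_upwards [eventually_ge_atTop M] with N hN i hi x hx
  have h0 := π.t_mem_Icc (N := N) hi.le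
  have h1 := π.t_mem_Icc (N := N) (i := i + 1) hi
  refine (h x ⟨h0.1.trans hx.1, hx.2.trans h1.2⟩ _ h0 ?_).le
  rw [Real.dist_eq, abs_of_nonneg (sub_nonneg.2 hx.1)]
  linarith [hM N hN i hi, hx.2]

end PartitionSeq

/-- The integral of `f` over `[s 0, s k]` is close to the integral of the left-endpoint step
function, written in terms of the masses of the intervals `[s 0, s i]`. -/
lemma abs_setIntegral_sub_riemannSum_le (ν : Measure ℝ) [IsFiniteMeasureOnCompacts ν]
    {f : ℝ → ℝ} {s : ℕ → ℝ} {δ : ℝ} (hδ : 0 ≤ δ) (k : ℕ) (hs : ∀ i < k, s i ≤ s (i + 1))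
    (hf : ContinuousOn f (Set.Icc (s 0) (s k)))
    (hosc : ∀ i < k, ∀ x ∈ Set.Icc (s i) (s (i + 1)), |f x - f (s i)| ≤ δ) :
    |(∫ x in Set.Icc (s 0) (s k), f x ∂ν) -
      (f (s 0) * ν.real {s 0} + ∑ i ∈ Finset.range k, f (s i) *
        (ν.real (Set.Icc (s 0) (s (i + 1))) - ν.real (Set.Icc (s 0) (s i))))| ≤
      δ * ν.real (Set.Icc (s 0) (s k)) := by
  induction k with
  | zero =>
    simp only [Set.Icc_self, integral_singleton, smul_eq_mul, Finset.range_zero, Finset.sum_empty]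
    rw [mul_comm, add_zero, sub_self, abs_zero]
    positivity
  | succ k ih =>
    have h0k : s 0 ≤ s k := by
      have hmono : ∀ j ≤ k, s 0 ≤ s j := fun j hj => by
        induction j with
        | zero => exact le_rfl
        | succ j ihj => exact (ihj (by omega)).trans (hs j (by omega))
      exact hmono k le_rfl
    have hk := hs k k.lt_succ_self
    have hint := hf.integrableOn_compact (μ := ν) isCompact_Icc
    have hIoc : Set.Ioc (s k) (s (k + 1)) ⊆ Set.Icc (s 0) (s (k + 1)) :=
      fun x hx => ⟨h0k.trans hx.1.le, hx.2⟩
    have hIcc : Set.Icc (s 0) (s k) ⊆ Set.Icc (s 0) (s (k + 1)) := Set.Icc_subset_Icc_right hk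
    have hdisj : Disjoint (Set.Icc (s 0) (s k)) (Set.Ioc (s k) (s (k + 1))) :=
      Set.disjoint_left.2 fun x hx hx' => hx'.1.not_ge hx.2
    have hfin : ν (Set.Ioc (s k) (s (k + 1))) < ⊤ :=
      (measure_mono hIoc).trans_lt isCompact_Icc.measure_lt_top
    have hsplit := setIntegral_union hdisj measurableSet_Ioc (hint.mono_set hIcc)
      (hint.mono_set hIoc)
    have hmeas := measureReal_union hdisj measurableSet_Ioc
      (isCompact_Icc.measure_lt_top (μ := ν)).ne hfin.ne
    rw [Set.Icc_union_Ioc_eq_Icc h0k hk] at hsplit hmeas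
    have hstep := norm_setIntegral_le_of_norm_le_const (f := fun x => f x - f (s k)) hfin
      fun x hx => hosc k k.lt_succ_self x ⟨hx.1.le, hx.2⟩
    rw [integral_sub (hint.mono_set hIoc) (integrableOn_const hfin.ne), setIntegral_const,
      smul_eq_mul, Real.norm_eq_abs] at hstep
    have hprev := ih (fun i hi => hs i (by omega)) (hf.mono hIcc) fun i hi => hosc i (by omega)
    rw [Finset.sum_range_succ, hsplit, hmeas]
    rw [abs_le] at hstep hprev ⊢
    constructor <;> linarith [hstep.1, hstep.2, hprev.1, hprev.2]

/-- Convergence of the masses of all intervals `[0, t]` implies convergence of the integrals of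
continuous functions over `[0, T]`. -/
lemma PartitionSeq.tendsto_setIntegral {T : ℝ} (π : PartitionSeq T) {ν : ℕ → Measure ℝ}
    [∀ N, IsFiniteMeasureOnCompacts (ν N)] {μ : Measure ℝ} [IsFiniteMeasureOnCompacts μ]
    (h : ∀ t ∈ Set.Icc 0 T, Tendsto (fun N => (ν N).real (Set.Icc 0 t)) atTop
      (𝓝 (μ.real (Set.Icc 0 t))))
    {f : ℝ → ℝ} (hf : ContinuousOn f (Set.Icc 0 T)) :
    Tendsto (fun N => ∫ x in Set.Icc 0 T, f x ∂ν N) atTop (𝓝 (∫ x in Set.Icc 0 T, f x ∂μ)) := by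
  refine Metric.tendsto_atTop'.2 fun ε hε => ?_
  set C := μ.real (Set.Icc 0 T)
  have hC0 : 0 ≤ C := measureReal_nonneg
  have hδ : 0 < ε / (2 * C + 1) := by positivity
  set δ := ε / (2 * C + 1)
  obtain ⟨M, hM⟩ := (π.eventually_abs_sub_le hf hδ).exists
  let R : Measure ℝ → ℝ := fun ρ => f 0 * ρ.real {0} +
    ∑ i ∈ Finset.range (π.c M), f (π.t M i) *
      (ρ.real (Set.Icc 0 (π.t M (i + 1))) - ρ.real (Set.Icc 0 (π.t M i)))
  have happrox (ρ : Measure ℝ) [IsFiniteMeasureOnCompacts ρ] :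
      |(∫ x in Set.Icc 0 T, f x ∂ρ) - R ρ| ≤ δ * ρ.real (Set.Icc 0 T) := by
    have := abs_setIntegral_sub_riemannSum_le ρ (s := π.t M) hδ.le (π.c M)
      (fun i hi => (π.mono M i hi).le) (by rwa [π.first, π.last]) hM
    rwa [π.last, π.first M] at this
  have hR : Tendsto (fun N => R (ν N)) atTop (𝓝 (R μ)) := by
    simp only [R, ← Set.Icc_self]
    refine .add (.const_mul _ (h 0 ?_)) (tendsto_finsetSum _ fun i hi => .const_mul _
      ((h _ (π.t_mem_Icc ?_)).sub (h _ (π.t_mem_Icc ?_))))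
    · simpa [π.first] using π.t_mem_Icc (N := M) (Nat.zero_le _)
    · exact Finset.mem_range.1 hi
    · exact (Finset.mem_range.1 hi).le
  have hT : T ∈ Set.Icc 0 T := by simpa [π.last] using π.t_mem_Icc (N := M) le_rfl
  have hlim : Tendsto (fun N => δ * (ν N).real (Set.Icc 0 T) + |R (ν N) - R μ| + δ * C) atTop
      (𝓝 (δ * C + |R μ - R μ| + δ * C)) :=
    (((h T hT).const_mul δ).add (hR.sub_const _).abs).add_const _
  have hlt : δ * C + |R μ - R μ| + δ * C < ε := by
    have : δ * (2 * C + 1) = ε := div_mul_cancel₀ _ (by positivity)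
    rw [sub_self, abs_zero]
    linarith
  obtain ⟨N₀, hN₀⟩ := eventually_atTop.1 (hlim.eventually_lt_const hlt)
  refine ⟨N₀, fun N hN => lt_of_le_of_lt ?_ (hN₀ N hN.le)⟩
  have h1 := abs_le.1 (happrox (ν N))
  have h2 := abs_le.1 (happrox μ)
  have h3 := abs_le.1 (le_refl |R (ν N) - R μ|)
  rw [Real.dist_eq, abs_le]
  constructor <;> linarith [h1.1, h1.2, h2.1, h2.2, h3.1, h3.2]

lemma setIntegral_sum_dirac (n : ℕ) (w : ℕ → ℝ) (hw : ∀ i, 0 ≤ w i) (p : ℕ → ℝ) {s : Set ℝ}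
    [DecidablePred (· ∈ s)] (hs : MeasurableSet s) (f : ℝ → ℝ) :
    ∫ x in s, f x ∂(∑ i ∈ Finset.range n, ENNReal.ofReal (w i) • Measure.dirac (p i)) =
      ∑ i ∈ (Finset.range n).filter (fun i => p i ∈ s), f (p i) * w i := by
  rw [← integral_indicator hs, integral_finsetSum_measure fun i _ =>
    (integrable_dirac enorm_lt_top).smul_measure ENNReal.ofReal_ne_top, Finset.sum_filter]
  refine Finset.sum_congr rfl fun i _ => ?_
  rw [integral_smul_measure, integral_dirac, ENNReal.toReal_ofReal (hw i), smul_eq_mul,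
    Set.indicator_apply]
  split_ifs <;> ring

lemma StieltjesFunction.measureReal_Icc_of_continuous (F : StieltjesFunction ℝ)
    (hF : Continuous F) {a b : ℝ} (hab : a ≤ b) : F.measure.real (Set.Icc a b) = F b - F a := by
  rw [measureReal_def, F.measure_Icc, hF.continuousWithinAt.leftLim_eq,
    ENNReal.toReal_ofReal (sub_nonneg.2 (F.mono hab))]

/-- Equation (10): Riemann sums of `Y_u (X_v - X_u)²` and of `Y_u ([X]_v - [X]_u)` both
converge to the Lebesgue–Stieltjes integral `∫_{[0,T]} Y d[X]`. -/
theorem quadratic_variation_riemann_sums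
    (T : ℝ) (hT : 0 < T) (π : PartitionSeq T)
    (X : ℝ → ℝ) (hXc : ContinuousOn X (Set.Icc 0 T))
    (Y : ℝ → ℝ) (hYc : ContinuousOn Y (Set.Icc 0 T))
    (QV : ℝ → ℝ) (hQVmono : Monotone QV) (hQVc : Continuous QV)
    (hconv : ∀ t ∈ Set.Icc (0 : ℝ) T,
      Tendsto (fun N => ∑ i ∈ (Finset.range (π.c N)).filter (fun i => π.t N i ≤ t),
          (X (π.t N (i + 1)) - X (π.t N i)) ^ 2)
        atTop (nhds (QV t))) :
    Tendsto (fun N => ∑ i ∈ Finset.range (π.c N),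
        Y (π.t N i) * (X (π.t N (i + 1)) - X (π.t N i)) ^ 2)
      atTop (nhds (∫ s in Set.Icc (0 : ℝ) T, Y s
        ∂(StieltjesFunction.mk QV hQVmono
            (fun x => hQVc.continuousWithinAt)).measure)) ∧
    Tendsto (fun N => ∑ i ∈ Finset.range (π.c N),
        Y (π.t N i) * (QV (π.t N (i + 1)) - QV (π.t N i)))
      atTop (nhds (∫ s in Set.Icc (0 : ℝ) T, Y s
        ∂(StieltjesFunction.mk QV hQVmono
            (fun x => hQVc.continuousWithinAt)).measure)) := by
  set F := StieltjesFunction.mk QV hQVmono (fun x => hQVc.continuousWithinAt)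
  have hmeas {a b : ℝ} (hab : a ≤ b) : F.measure.real (Set.Icc a b) = QV b - QV a :=
    F.measureReal_Icc_of_continuous hQVc hab
  have hQV0 : QV 0 = 0 := by
    have hsmall : Tendsto (fun N => X (π.t N 1) - X (π.t N 0)) atTop (𝓝 0) := by
      refine Metric.tendsto_nhds.2 fun ε hε => ?_
      filter_upwards [π.eventually_abs_sub_le hXc (half_pos hε)] with N hN
      rw [Real.dist_eq, sub_zero]
      exact (hN 0 (π.c_pos N) _ (Set.right_mem_Icc.2 (π.mono N 0 (π.c_pos N)).le)).trans_lt
        (half_lt_self hε)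
    refine tendsto_nhds_unique (hconv 0 (Set.left_mem_Icc.2 hT.le)) ?_
    convert hsmall.pow 2 using 2 with N
    · have : (Finset.range (π.c N)).filter (fun i => π.t N i ≤ 0) = {0} := by
        ext i
        simp only [Finset.mem_filter, Finset.mem_range, Finset.mem_singleton]
        refine ⟨fun ⟨hi, hle⟩ => ?_, ?_⟩
        · by_contra hne
          have h1 := π.mono N 0 (π.c_pos N)
          have h2 := π.t_le_t (N := N) (i := 0 + 1) (j := i) (by omega) hi.le
          rw [π.first] at h1
          linarith
        · rintro rfl
          exact ⟨π.c_pos N, (π.first N).le⟩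
      rw [this, Finset.sum_singleton]
    · norm_num
  constructor
  · let w : ℕ → ℕ → ℝ := fun N i => (X (π.t N (i + 1)) - X (π.t N i)) ^ 2
    have hw (N i : ℕ) : 0 ≤ w N i := sq_nonneg _
    let ν : ℕ → Measure ℝ := fun N =>
      ∑ i ∈ Finset.range (π.c N), ENNReal.ofReal (w N i) • Measure.dirac (π.t N i)
    have : ∀ N, IsFiniteMeasure (ν N) := fun N =>
      have (i : ℕ) : IsFiniteMeasure (ENNReal.ofReal (w N i) • Measure.dirac (π.t N i)) :=
        Measure.smul_finite _ ENNReal.ofReal_ne_top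
      inferInstance
    have hν (N : ℕ) (t : ℝ) (f : ℝ → ℝ) : ∫ x in Set.Icc 0 t, f x ∂ν N =
        ∑ i ∈ (Finset.range (π.c N)).filter (fun i => π.t N i ≤ t), f (π.t N i) * w N i := by
      classical
      rw [setIntegral_sum_dirac _ _ (hw N) _ measurableSet_Icc]
      refine Finset.sum_congr (Finset.filter_congr fun i hi => ?_) fun _ _ => rfl
      exact and_iff_right (π.t_mem_Icc (Finset.mem_range.1 hi).le).1
    have hlim := π.tendsto_setIntegral (ν := ν) (μ := F.measure) (fun t ht => ?_) hYc
    · refine hlim.congr fun N => ?_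
      rw [hν, Finset.filter_true_of_mem fun i hi => (π.t_mem_Icc (Finset.mem_range.1 hi).le).2]
    · rw [hmeas ht.1, hQV0, sub_zero]
      refine (hconv t ht).congr fun N => ?_
      have := hν N t fun _ => 1
      simp only [setIntegral_const, smul_eq_mul, mul_one, one_mul] at this
      exact this.symm
  · refine Metric.tendsto_nhds.2 fun ε hε => ?_
    have hQVT : 0 ≤ QV T := hQV0 ▸ hQVmono hT.le
    have hδ : 0 < ε / (QV T + 1) := by positivity
    filter_upwards [π.eventually_abs_sub_le hYc hδ] with N hN
    have hsum := abs_setIntegral_sub_riemannSum_le F.measure (s := π.t N) hδ.le (π.c N)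
      (fun i hi => (π.mono N i hi).le) (by rwa [π.first, π.last]) hN
    rw [← Set.Icc_self, hmeas le_rfl, sub_self, mul_zero, zero_add, π.last, π.first,
      hmeas hT.le, hQV0, sub_zero, abs_sub_comm] at hsum
    have hlt : ε / (QV T + 1) * QV T < ε := by
      have : ε / (QV T + 1) * (QV T + 1) = ε := div_mul_cancel₀ _ (by positivity)
      linarith
    have heq : ∑ i ∈ Finset.range (π.c N), Y (π.t N i) * (QV (π.t N (i + 1)) - QV (π.t N i)) =
        ∑ i ∈ Finset.range (π.c N), Y (π.t N i) * (F.measure.real (Set.Icc 0 (π.t N (i + 1))) -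
          F.measure.real (Set.Icc 0 (π.t N i))) := by
      refine Finset.sum_congr rfl fun i hi => ?_
      have hi := Finset.mem_range.1 hi
      rw [hmeas (π.t_mem_Icc (i := i + 1) hi).1, hmeas (π.t_mem_Icc hi.le).1]
      ring
    rw [Real.dist_eq, heq]
    exact hsum.trans_lt hlt
end

section
/- (Gamma-neutral hedging of Asian options.) Let T > 0, σ > 0, and let π = (π_N) be a sequence of partitions of [0,T] with mesh tending to 0. Let X : [0,T] → ℝ be a continuous path with vanishing p-th variation along π for some p ≤ 3, and define I_t := ∫_0^t X_u du. For i = 0,…,n let F^i : [0,T] × ℝ × ℝ → ℝ be three times continuously differentiable on a neighbourhood of the path {(t, I_t, X_t) : t ∈ [0,T]}, and let q^i : [0,T] → ℝ be bounded. Suppose that for all t ∈ [0,T]: (a) ∂F^i/∂t (t, I_t, X_t) + X_t ∂F^i/∂I (t, I_t, X_t) + (1/2) σ² X_t² ∂²F^i/∂X² (t, I_t, X_t) = 0 for every i; (b) Σ_{i=0}^n q^i_t ∂F^i/∂X (t, I_t, X_t) = 0 (delta neutrality); and (c) Σ_{i=0}^n q^i_t ∂²F^i/∂X² (t, I_t,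 X_t) = 0 (gamma neutrality). Then lim_{N→∞} Σ_{[u,v]∈π_N} Σ_{i=0}^n q^i_u ( F^i(v, I_v, X_v) − F^i(u, I_u, X_u) ) = 0. -/
open Filter Topology

open Set

/-- Second-order Taylor estimate from a bound on the third derivative. -/
theorem abs_taylor_two_le {g g₁ g₂ g₃ : ℝ → ℝ} {x₀ r L : ℝ}
    (h₁ : ∀ y ∈ Metric.closedBall x₀ r, HasDerivAt g (g₁ y) y)
    (h₂ : ∀ y ∈ Metric.closedBall x₀ r, HasDerivAt g₁ (g₂ y) y)
    (h₃ : ∀ y ∈ Metric.closedBall x₀ r, HasDerivAt g₂ (g₃ y) y)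
    (hL : ∀ y ∈ Metric.closedBall x₀ r, |g₃ y| ≤ L)
    {x : ℝ} (hx : x ∈ Metric.closedBall x₀ r) :
    |g x - g x₀ - g₁ x₀ * (x - x₀) - 1 / 2 * g₂ x₀ * (x - x₀) ^ 2| ≤ L * |x - x₀| ^ 3 := by
  have key : ∀ {f f' : ℝ → ℝ} {C ρ : ℝ}, 0 ≤ ρ →
      (∀ y ∈ Metric.closedBall x₀ ρ, HasDerivAt f (f' y) y) →
      (∀ y ∈ Metric.closedBall x₀ ρ, |f' y| ≤ C) →
      ∀ y ∈ Metric.closedBall x₀ ρ, |f y - f x₀| ≤ C * |y - x₀| := fun hρ hf hC y hy =>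
    (convex_closedBall x₀ _).norm_image_sub_le_of_norm_hasDerivWithin_le
      (fun z hz => (hf z hz).hasDerivWithinAt) hC (Metric.mem_closedBall_self hρ) hy
  set ρ := |x - x₀| with hρ
  have hρ0 : 0 ≤ ρ := abs_nonneg _
  have hxr : ρ ≤ r := by simpa [Real.dist_eq] using hx
  have hsub : Metric.closedBall x₀ ρ ⊆ Metric.closedBall x₀ r :=
    Metric.closedBall_subset_closedBall hxr
  have hL0 : 0 ≤ L := (abs_nonneg _).trans (hL x hx)
  have hdist : ∀ y ∈ Metric.closedBall x₀ ρ, |y - x₀| ≤ ρ := fun y hy => by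
    simpa [Real.dist_eq] using hy
  have b₂ : ∀ y ∈ Metric.closedBall x₀ ρ, |g₂ y - g₂ x₀| ≤ L * ρ := fun y hy =>
    (key hρ0 (fun z hz => h₃ z (hsub hz)) (fun z hz => hL z (hsub hz)) y hy).trans
      (mul_le_mul_of_nonneg_left (hdist y hy) hL0)
  have b₁ : ∀ y ∈ Metric.closedBall x₀ ρ, |g₁ y - g₁ x₀ - g₂ x₀ * (y - x₀)| ≤ L * ρ * ρ := by
    intro y hy
    have := key (f := fun z => g₁ z - g₂ x₀ * (z - x₀)) (f' := fun z => g₂ z - g₂ x₀) hρ0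
      (fun z hz => ((h₂ z (hsub hz)).sub
        (((hasDerivAt_id z).sub_const x₀).const_mul (g₂ x₀))).congr_deriv (by simp))
      b₂ y hy
    refine le_trans (le_of_eq ?_)
      (this.trans (mul_le_mul_of_nonneg_left (hdist y hy) (by positivity)))
    congr 1
    ring
  have := key (f := fun z => g z - g₁ x₀ * (z - x₀) - 1 / 2 * g₂ x₀ * (z - x₀) ^ 2)
    (f' := fun z => g₁ z - g₁ x₀ - g₂ x₀ * (z - x₀)) hρ0
    (fun z hz => by
      have e := (hasDerivAt_id z).sub_const x₀
      refine (((h₁ z (hsub hz)).sub (e.const_mul (g₁ x₀))).sub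
        ((e.pow 2).const_mul (1 / 2 * g₂ x₀))).congr_deriv ?_
      simp
      ring)
    b₁ x (by simp [Real.dist_eq, hρ])
  refine le_trans (le_of_eq ?_) (this.trans (le_of_eq ?_))
  · congr 1
    ring
  · rw [← hρ]
    ring

/-- Partition points lie in the interval. -/
theorem PartitionSeq.mem_Icc_s11 {T : ℝ} (π : PartitionSeq T) (N : ℕ) {k : ℕ} (hk : k ≤ π.c N) :
    π.t N k ∈ Icc 0 T := by
  have hmono : ∀ j ≤ π.c N, ∀ i ≤ j, π.t N i ≤ π.t N j := by
    intro j
    induction j with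
    | zero => intro _ i hi; simp [Nat.le_zero.mp hi]
    | succ j ih =>
      intro hj i hi
      rcases Nat.le_succ_iff.mp hi with h | h
      · exact (ih (by omega) i h).trans (π.mono N j (by omega)).le
      · rw [h]
  exact ⟨(π.first N).ge.trans (hmono k hk 0 (Nat.zero_le _)),
    (hmono _ le_rfl k hk).trans (π.last N).le⟩

/-- Riemann-type sums of a two-parameter function dominated by `ε (v - u) + C ‖X v - X u‖ ^ p`
along short intervals vanish in the limit if `X` has vanishing `p`-th variation. -/
theorem VanishingVariation.tendsto_sum_zero {V : Type*} [NormedAddCommGroup V] {T : ℝ}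
    {π : PartitionSeq T} {p : ℝ} {X : ℝ → V} (hX : VanishingVariation π p X) (hT : 0 < T)
    {R : ℝ → ℝ → ℝ}
    (hR : ∀ ε > 0, ∃ C : ℝ, ∃ δ > 0, ∀ u ∈ Icc 0 T, ∀ v ∈ Icc 0 T, u < v → v - u < δ →
      |R u v| ≤ ε * (v - u) + C * ‖X v - X u‖ ^ p) :
    Tendsto (fun N => ∑ k ∈ Finset.range (π.c N), R (π.t N k) (π.t N (k + 1)))
      atTop (𝓝 0) := by
  rw [Metric.tendsto_atTop]
  intro ε hε
  obtain ⟨C, δ, hδ, h⟩ := hR (ε / (2 * T)) (by positivity)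
  obtain ⟨M₁, hM₁⟩ := π.mesh_to_zero δ hδ
  have hlim := hX.const_mul C
  rw [mul_zero] at hlim
  obtain ⟨M₂, hM₂⟩ := eventually_atTop.mp (hlim.eventually_lt_const (half_pos hε))
  refine ⟨max M₁ M₂, fun N hN => ?_⟩
  rw [Real.dist_0_eq_abs]
  calc |∑ k ∈ Finset.range (π.c N), R (π.t N k) (π.t N (k + 1))|
      ≤ ∑ k ∈ Finset.range (π.c N), |R (π.t N k) (π.t N (k + 1))| :=
        Finset.abs_sum_le_sum_abs _ _
    _ ≤ ∑ k ∈ Finset.range (π.c N), (ε / (2 * T) * (π.t N (k + 1) - π.t N k) +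
          C * ‖X (π.t N (k + 1)) - X (π.t N k)‖ ^ p) := by
        refine Finset.sum_le_sum fun k hk => ?_
        have hk := Finset.mem_range.mp hk
        exact h _ (π.mem_Icc_s11 N hk.le) _ (π.mem_Icc_s11 N hk) (π.mono N k hk)
          (hM₁ N (le_of_max_le_left hN) k hk)
    _ = ε / 2 + C * ∑ k ∈ Finset.range (π.c N),
          ‖X (π.t N (k + 1)) - X (π.t N k)‖ ^ p := by
        rw [Finset.sum_add_distrib, ← Finset.mul_sum, ← Finset.mul_sum, Finset.sum_range_sub,
          π.first, π.last]
        congr 1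
        field_simp
        ring
    _ < ε := by linarith [hM₂ N (le_of_max_le_right hN)]

/-- The running integral is differentiable to first order, uniformly on `[0, T]`. -/
theorem exists_abs_integral_sub_sub_le {T : ℝ} {X : ℝ → ℝ} (hX : ContinuousOn X (Icc 0 T))
    {ε : ℝ} (hε : 0 < ε) : ∃ δ > 0, ∀ u ∈ Icc 0 T, ∀ v ∈ Icc 0 T, u < v → v - u < δ →
      |(∫ s in (0 : ℝ)..v, X s) - (∫ s in (0 : ℝ)..u, X s) - X u * (v - u)| ≤ ε * (v - u) := by
  obtain ⟨δ, hδ, h⟩ := Metric.uniformContinuousOn_iff.mp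
    (isCompact_Icc.uniformContinuousOn_of_continuous hX) ε hε
  refine ⟨δ, hδ, fun u hu v hv huv hlt => ?_⟩
  have hint : ∀ a ∈ Icc 0 T, ∀ b ∈ Icc 0 T, IntervalIntegrable X MeasureTheory.volume a b :=
    fun a ha b hb => (hX.mono (uIcc_subset_Icc ha hb)).intervalIntegrable
  have h0 : (0 : ℝ) ∈ Icc 0 T := ⟨le_rfl, hu.1.trans hu.2⟩
  have hconst : X u * (v - u) = ∫ _ in u..v, X u := by simp [mul_comm]
  rw [intervalIntegral.integral_interval_sub_left (hint _ h0 _ hv) (hint _ h0 _ hu), hconst,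
    ← intervalIntegral.integral_sub (hint _ hu _ hv) intervalIntegrable_const]
  have := intervalIntegral.norm_integral_le_of_norm_le_const (a := u) (b := v) (C := ε)
    (f := fun s => X s - X u) (fun s hs => ?_)
  · rwa [abs_of_pos (sub_pos.mpr huv)] at this
  · rw [uIoc_of_le huv.le] at hs
    refine (h s ⟨hu.1.trans hs.1.le, hs.2.trans hv.2⟩ u hu ?_).le
    rw [Real.dist_eq, abs_of_pos (sub_pos.mpr hs.1)]
    linarith [hs.2]

/-- Derivative in the third variable. -/
noncomputable def partialThird (f : ℝ × ℝ × ℝ → ℝ) (z : ℝ × ℝ × ℝ) : ℝ :=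
  fderiv ℝ f z (0, 0, 1)

theorem ContDiffOn.partialThird {f : ℝ × ℝ × ℝ → ℝ} {U : Set (ℝ × ℝ × ℝ)} (hU : IsOpen U)
    {m k : WithTop ℕ∞} (hf : ContDiffOn ℝ k f U) (hmk : m + 1 ≤ k) :
    ContDiffOn ℝ m (partialThird f) U :=
  (hf.fderiv_of_isOpen hU hmk).clm_apply contDiffOn_const

theorem ContDiffOn.hasDerivAt_partialThird {f : ℝ × ℝ × ℝ → ℝ} {U : Set (ℝ × ℝ × ℝ)}
    (hU : IsOpen U) {k : WithTop ℕ∞} (hf : ContDiffOn ℝ k f U) (hk : k ≠ 0) {a b x : ℝ}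
    (hx : (a, b, x) ∈ U) :
    HasDerivAt (fun y => f (a, b, y)) (_root_.partialThird f (a, b, x)) x := by
  have hd : HasFDerivAt f (fderiv ℝ f (a, b, x)) (a, b, x) :=
    ((hf.differentiableOn hk).differentiableAt (hU.mem_nhds hx)).hasFDerivAt
  exact hd.comp_hasDerivAt x
    ((hasDerivAt_const x a).prodMk ((hasDerivAt_const x b).prodMk (hasDerivAt_id x)))

/-- Pathwise expansion of a `C³` function of time, running integral and path: first order in time,
second order in the path. -/
theorem exists_abs_asian_expansion_le {T : ℝ} {X : ℝ → ℝ} (hX : ContinuousOn X (Icc 0 T))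
    {U : Set (ℝ × ℝ × ℝ)} (hU : IsOpen U)
    (hpath : ∀ t ∈ Icc (0 : ℝ) T, (t, ∫ s in (0 : ℝ)..t, X s, X t) ∈ U)
    {f : ℝ × ℝ × ℝ → ℝ} (hf : ContDiffOn ℝ 3 f U) {ε : ℝ} (hε : 0 < ε) :
    ∃ L ≥ 0, ∃ δ > 0, ∀ u ∈ Icc 0 T, ∀ v ∈ Icc 0 T, u < v → v - u < δ →
      |X v - X u| ≤ 1 ∧
      |f (v, ∫ s in (0 : ℝ)..v, X s, X v) - f (u, ∫ s in (0 : ℝ)..u, X s, X u)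
        - (fderiv ℝ f (u, ∫ s in (0 : ℝ)..u, X s, X u) (1, 0, 0)
            + X u * fderiv ℝ f (u, ∫ s in (0 : ℝ)..u, X s, X u) (0, 1, 0)) * (v - u)
        - partialThird f (u, ∫ s in (0 : ℝ)..u, X s, X u) * (X v - X u)
        - 1 / 2 * partialThird (partialThird f) (u, ∫ s in (0 : ℝ)..u, X s, X u)
            * (X v - X u) ^ 2|
        ≤ ε * (v - u) + L * |X v - X u| ^ 3 := by
  set J : ℝ → ℝ := fun t => ∫ s in (0 : ℝ)..t, X s with hJ
  set γ : ℝ → ℝ × ℝ × ℝ := fun t => (t, J t, X t) with hγdef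
  have hint : MeasureTheory.IntegrableOn X (Icc 0 T) := hX.integrableOn_Icc
  have hγ : ContinuousOn γ (Icc 0 T) := by
    refine continuousOn_id.prodMk (ContinuousOn.prodMk ?_ hX)
    rcases le_or_gt 0 T with h | h
    · have := intervalIntegral.continuousOn_primitive_interval (μ := MeasureTheory.volume)
        (f := X) (a := 0) (b := T) (by rwa [uIcc_of_le h])
      rwa [uIcc_of_le h] at this
    · simp [Icc_eq_empty_of_lt h]
  have hK : IsCompact (γ '' Icc 0 T) := isCompact_Icc.image_of_continuousOn hγ
  obtain ⟨r, hr, hrU⟩ := hK.exists_cthickening_subset_open hU (image_subset_iff.mpr hpath)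
  set K := Metric.cthickening r (γ '' Icc 0 T)
  have hKc : IsCompact K := hK.cthickening
  have hball : ∀ u ∈ Icc 0 T, Metric.closedBall (γ u) r ⊆ K := fun u hu =>
    Metric.closedBall_subset_cthickening (mem_image_of_mem γ hu) r
  have hf₁ : ContDiffOn ℝ 2 (partialThird f) U := hf.partialThird hU (by norm_num)
  have hf₂ : ContDiffOn ℝ 1 (partialThird (partialThird f)) U :=
    hf₁.partialThird hU (by norm_num)
  have hf₃ : ContDiffOn ℝ 0 (partialThird (partialThird (partialThird f))) U :=
    hf₂.partialThird hU (by norm_num)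
  have hDf : ContinuousOn (fderiv ℝ f) K :=
    (hf.continuousOn_fderiv_of_isOpen hU (by norm_num)).mono hrU
  obtain ⟨L, hL⟩ := hKc.exists_bound_of_continuousOn (hf₃.continuousOn.mono hrU)
  obtain ⟨B, hB⟩ := hKc.exists_bound_of_continuousOn hDf
  obtain ⟨M, hM⟩ := isCompact_Icc.exists_bound_of_continuousOn hX
  set A := 1 + |B| + (|M| + 2) with hA
  have hApos : 0 < A := by positivity
  set η := min (ε / A) 1 with hη
  have hη0 : 0 < η := by positivity
  obtain ⟨ρ, hρ, hunif⟩ := Metric.uniformContinuousOn_iff.mp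
    (hKc.uniformContinuousOn_of_continuous hDf) η hη0
  set τ := min (min r (ρ / 2)) 1 with hτ
  have hτ0 : 0 < τ := by positivity
  obtain ⟨δ₁, hδ₁, hγu⟩ := Metric.uniformContinuousOn_iff.mp
    (isCompact_Icc.uniformContinuousOn_of_continuous hγ) τ hτ0
  obtain ⟨δ₂, hδ₂, hJu⟩ := exists_abs_integral_sub_sub_le hX hη0
  refine ⟨|L|, abs_nonneg _, min δ₁ δ₂, lt_min hδ₁ hδ₂, fun u hu v hv huv hlt => ?_⟩
  have hh : 0 < v - u := sub_pos.mpr huv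
  have hdist : dist (γ v) (γ u) < τ := hγu v hv u hu (by
    rw [Real.dist_eq, abs_of_pos hh]; exact hlt.trans_le (min_le_left _ _))
  have hJ' := hJu u hu v hv huv (hlt.trans_le (min_le_right _ _))
  change |J v - J u - X u * (v - u)| ≤ η * (v - u) at hJ'
  have hτr : τ ≤ r := (min_le_left _ _).trans (min_le_left _ _)
  have hτρ : τ < ρ := by
    have : τ ≤ ρ / 2 := (min_le_left _ _).trans (min_le_right _ _)
    linarith
  have hdX : |X v - X u| < τ := by
    rw [← Real.dist_eq]
    exact ((le_max_right _ _).trans (le_max_right _ _)).trans_lt hdist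
  refine ⟨hdX.le.trans (min_le_right _ _), ?_⟩
  have hvert : ∀ y ∈ Metric.closedBall (X u) τ, (u, J u, y) ∈ Metric.closedBall (γ u) τ := by
    intro y hy
    simpa [γ, Prod.dist_eq, hτ0.le] using hy
  have hKmem : ∀ z ∈ Metric.closedBall (γ u) τ, z ∈ K := fun z hz =>
    hball u hu (Metric.closedBall_subset_closedBall hτr hz)
  have hXv : X v ∈ Metric.closedBall (X u) τ := by
    rw [Metric.mem_closedBall, Real.dist_eq]; exact hdX.le
  have htaylor := abs_taylor_two_le (x₀ := X u) (r := τ) (L := |L|)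
    (fun y hy => hf.hasDerivAt_partialThird hU (by norm_num) (hrU (hKmem _ (hvert y hy))))
    (fun y hy => hf₁.hasDerivAt_partialThird hU (by norm_num) (hrU (hKmem _ (hvert y hy))))
    (fun y hy => hf₂.hasDerivAt_partialThird hU (by norm_num) (hrU (hKmem _ (hvert y hy))))
    (fun y hy => (hL _ (hKmem _ (hvert y hy))).trans (le_abs_self L)) hXv
  have hmv := (convex_closedBall (γ u) τ).norm_image_sub_le_of_norm_hasFDerivWithin_le'
    (f := f) (f' := fderiv ℝ f) (φ := fderiv ℝ f (γ u)) (C := η)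
    (fun z hz => ((hf.differentiableOn (by norm_num)).differentiableAt
      (hU.mem_nhds (hrU (hKmem z hz)))).hasFDerivAt.hasFDerivWithinAt)
    (fun z hz => by
      rw [← dist_eq_norm]
      exact (hunif z (hKmem z hz) (γ u) (hKmem _ (Metric.mem_closedBall_self hτ0.le))
        (lt_of_le_of_lt hz hτρ)).le)
    (hvert _ hXv) (show γ v ∈ Metric.closedBall (γ u) τ from hdist.le)
  have hdiff : γ v - (u, J u, X v) =
      (v - u) • ((1 : ℝ), (0 : ℝ), (0 : ℝ)) + (J v - J u) • ((0 : ℝ), (1 : ℝ), (0 : ℝ)) := by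
    simp [γ]
  have hη1 : η ≤ 1 := min_le_right _ _
  have hJb : |J v - J u| ≤ (|M| + 1) * (v - u) := by
    have h1 : |X u| ≤ |M| := (hM u hu).trans (le_abs_self M)
    have h2 : |X u * (v - u)| ≤ |M| * (v - u) := by
      rw [abs_mul, abs_of_pos hh]; gcongr
    have h3 : η * (v - u) ≤ 1 * (v - u) := by gcongr
    have := abs_add_le (J v - J u - X u * (v - u)) (X u * (v - u))
    rw [sub_add_cancel] at this
    linarith
  have hnorm : ‖γ v - (u, J u, X v)‖ ≤ (|M| + 2) * (v - u) := by
    have : 0 ≤ |M| * (v - u) := by positivity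
    simp only [γ, Prod.mk_sub_mk, sub_self, Prod.norm_mk, Real.norm_eq_abs, abs_zero]
    rw [abs_of_pos hh]
    refine max_le (by linarith) (max_le (by linarith) (by positivity))
  have hmv' : |f (γ v) - f (u, J u, X v) - ((v - u) * fderiv ℝ f (γ u) (1, 0, 0)
      + (J v - J u) * fderiv ℝ f (γ u) (0, 1, 0))| ≤ η * ((|M| + 2) * (v - u)) := by
    refine le_trans (le_of_eq ?_) (hmv.trans (mul_le_mul_of_nonneg_left hnorm hη0.le))
    rw [hdiff, map_add, map_smul, map_smul, smul_eq_mul, smul_eq_mul, Real.norm_eq_abs]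
  have hFI : |fderiv ℝ f (γ u) (0, 1, 0)| ≤ |B| := by
    have h1 := (fderiv ℝ f (γ u)).le_opNorm ((0 : ℝ), (1 : ℝ), (0 : ℝ))
    have h2 := hB (γ u) (hKmem _ (Metric.mem_closedBall_self hτ0.le))
    have h3 : ‖((0 : ℝ), (1 : ℝ), (0 : ℝ))‖ = 1 := by simp [Prod.norm_mk]
    rw [h3, mul_one, Real.norm_eq_abs] at h1
    exact (h1.trans h2).trans (le_abs_self B)
  have hJF : |(J v - J u - X u * (v - u)) * fderiv ℝ f (γ u) (0, 1, 0)| ≤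
      η * (v - u) * |B| := by
    rw [abs_mul]; gcongr
  have hηA : η * A ≤ ε := by
    rw [← le_div_iff₀ hApos]; exact min_le_left _ _
  have hfin : η * ((|M| + 2) * (v - u)) + η * (v - u) * |B| ≤ ε * (v - u) := by
    have h1 : η * A * (v - u) ≤ ε * (v - u) := by gcongr
    have h2 : η * A * (v - u) = η * ((|M| + 2) * (v - u)) + η * (v - u) * |B|
        + η * (v - u) := by rw [hA]; ring
    have : 0 ≤ η * (v - u) := by positivity
    linarith
  change |f (γ v) - f (γ u) - (fderiv ℝ f (γ u) (1, 0, 0) + X u * fderiv ℝ f (γ u) (0, 1, 0))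
    * (v - u) - partialThird f (γ u) * (X v - X u)
    - 1 / 2 * partialThird (partialThird f) (γ u) * (X v - X u) ^ 2| ≤ _
  change |f (u, J u, X v) - f (γ u) - partialThird f (γ u) * (X v - X u)
    - 1 / 2 * partialThird (partialThird f) (γ u) * (X v - X u) ^ 2| ≤ _ at htaylor
  rw [abs_le] at *
  constructor <;> linarith [hmv'.1, hmv'.2, hJF.1, hJF.2, htaylor.1, htaylor.2]

/-- Gamma-neutral hedging of Asian options in the Black–Scholes model:
the discrete profit-and-loss of a delta- and gamma-neutral portfolio of Asian-style
derivatives vanishes in the limit. Here `I_t = ∫_0^t X_u du` is the running integral. -/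
theorem asian_gamma_hedging
    (T : ℝ) (hT : 0 < T) (σ : ℝ) (hσ : 0 < σ) (π : PartitionSeq T)
    (p : ℝ) (hp : 1 ≤ p) (hp' : p ≤ 3)
    (X : ℝ → ℝ) (hXc : ContinuousOn X (Set.Icc 0 T))
    (hX : VanishingVariation π p X)
    (n : ℕ) (F : ℕ → ℝ × ℝ × ℝ → ℝ) (q : ℕ → ℝ → ℝ)
    -- each `F i` is three times continuously differentiable on a neighbourhood of the path
    (U : Set (ℝ × ℝ × ℝ)) (hU : IsOpen U)
    (hpath : ∀ t ∈ Set.Icc (0 : ℝ) T, (t, ∫ s in (0 : ℝ)..t, X s, X t) ∈ U)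
    (hF : ∀ i ≤ n, ContDiffOn ℝ 3 (F i) U)
    -- the `q i` are bounded
    (hq : ∀ i ≤ n, ∃ C : ℝ, ∀ t ∈ Set.Icc (0 : ℝ) T, |q i t| ≤ C)
    -- (a) the pricing PDE for Asian options along the path
    (hPDE : ∀ i ≤ n, ∀ t ∈ Set.Icc (0 : ℝ) T,
      fderiv ℝ (F i) (t, ∫ s in (0 : ℝ)..t, X s, X t) ((1 : ℝ), (0 : ℝ), (0 : ℝ)) +
        X t * fderiv ℝ (F i) (t, ∫ s in (0 : ℝ)..t, X s, X t) ((0 : ℝ), (1 : ℝ), (0 : ℝ)) +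
        (1 / 2) * σ ^ 2 * (X t) ^ 2 *
          fderiv ℝ (fun z => fderiv ℝ (F i) z ((0 : ℝ), (0 : ℝ), (1 : ℝ)))
            (t, ∫ s in (0 : ℝ)..t, X s, X t) ((0 : ℝ), (0 : ℝ), (1 : ℝ)) = 0)
    -- (b) delta neutrality
    (hdelta : ∀ t ∈ Set.Icc (0 : ℝ) T,
      ∑ i ∈ Finset.range (n + 1),
        q i t * fderiv ℝ (F i) (t, ∫ s in (0 : ℝ)..t, X s, X t)
          ((0 : ℝ), (0 : ℝ), (1 : ℝ)) = 0)
    -- (c) gamma neutrality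
    (hgamma : ∀ t ∈ Set.Icc (0 : ℝ) T,
      ∑ i ∈ Finset.range (n + 1),
        q i t * fderiv ℝ (fun z => fderiv ℝ (F i) z ((0 : ℝ), (0 : ℝ), (1 : ℝ)))
          (t, ∫ s in (0 : ℝ)..t, X s, X t) ((0 : ℝ), (0 : ℝ), (1 : ℝ)) = 0) :
    Tendsto (fun N => ∑ k ∈ Finset.range (π.c N), ∑ i ∈ Finset.range (n + 1),
        q i (π.t N k) *
          (F i (π.t N (k + 1), ∫ s in (0 : ℝ)..(π.t N (k + 1)), X s, X (π.t N (k + 1))) -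
            F i (π.t N k, ∫ s in (0 : ℝ)..(π.t N k), X s, X (π.t N k))))
      atTop (nhds 0) := by
  set γ : ℝ → ℝ × ℝ × ℝ := fun t => (t, ∫ s in (0 : ℝ)..t, X s, X t)
  set S : ℕ → ℝ → ℝ → ℝ := fun i u v =>
    F i (γ v) - F i (γ u)
      - (fderiv ℝ (F i) (γ u) (1, 0, 0) + X u * fderiv ℝ (F i) (γ u) (0, 1, 0)) * (v - u)
      - partialThird (F i) (γ u) * (X v - X u)
      - 1 / 2 * partialThird (partialThird (F i)) (γ u) * (X v - X u) ^ 2 with hS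
  have hlim : ∀ i ∈ Finset.range (n + 1), Tendsto (fun N => ∑ k ∈ Finset.range (π.c N),
      q i (π.t N k) * S i (π.t N k) (π.t N (k + 1))) atTop (𝓝 0) := by
    intro i hi
    have hi : i ≤ n := Nat.lt_succ_iff.mp (Finset.mem_range.mp hi)
    obtain ⟨C, hC⟩ := hq i hi
    have hC0 : 0 ≤ C := (abs_nonneg _).trans (hC 0 ⟨le_rfl, hT.le⟩)
    refine hX.tendsto_sum_zero (R := fun u v => q i u * S i u v) hT fun ε hε => ?_
    obtain ⟨L, hL0, δ, hδ, h⟩ := exists_abs_asian_expansion_le hXc hU hpath (hF i hi)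
      (ε := ε / (C + 1)) (by positivity)
    refine ⟨C * L, δ, hδ, fun u hu v hv huv hlt => ?_⟩
    obtain ⟨hsmall, hexp⟩ := h u hu v hv huv hlt
    have hpow : |X v - X u| ^ 3 ≤ |X v - X u| ^ p := by
      rw [← Real.rpow_natCast]
      exact Real.rpow_le_rpow_of_exponent_ge' (abs_nonneg _) hsmall (by linarith)
        (by exact_mod_cast hp')
    have hh : 0 < v - u := sub_pos.mpr huv
    have hCε : C * (ε / (C + 1)) ≤ ε := by
      rw [mul_div_assoc', div_le_iff₀ (by positivity)]
      nlinarith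
    rw [abs_mul, Real.norm_eq_abs]
    calc |q i u| * |S i u v|
        ≤ C * (ε / (C + 1) * (v - u) + L * |X v - X u| ^ 3) :=
          mul_le_mul (hC u hu) hexp (abs_nonneg _) hC0
      _ = C * (ε / (C + 1)) * (v - u) + C * L * |X v - X u| ^ 3 := by ring
      _ ≤ ε * (v - u) + C * L * |X v - X u| ^ p := by gcongr
  have hsum := tendsto_finsetSum _ hlim
  rw [Finset.sum_const_zero] at hsum
  refine hsum.congr fun N => ?_
  rw [Finset.sum_comm]
  refine Finset.sum_congr rfl fun k hk => ?_
  have hk := Finset.mem_range.mp hk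
  set u := π.t N k
  set v := π.t N (k + 1)
  have hu : u ∈ Icc 0 T := π.mem_Icc_s11 N hk.le
  have hsplit : ∀ i ∈ Finset.range (n + 1), q i u * S i u v =
      q i u * (F i (γ v) - F i (γ u))
        - (X v - X u) * (q i u * partialThird (F i) (γ u))
        + (1 / 2 * σ ^ 2 * X u ^ 2 * (v - u) - 1 / 2 * (X v - X u) ^ 2)
          * (q i u * partialThird (partialThird (F i)) (γ u)) := by
    intro i hi
    have e : fderiv ℝ (F i) (γ u) (1, 0, 0) + X u * fderiv ℝ (F i) (γ u) (0, 1, 0)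
        + 1 / 2 * σ ^ 2 * X u ^ 2 * partialThird (partialThird (F i)) (γ u) = 0 :=
      hPDE i (Nat.lt_succ_iff.mp (Finset.mem_range.mp hi)) u hu
    simp only [hS]
    linear_combination (-(q i u * (v - u))) * e
  have hd : ∑ i ∈ Finset.range (n + 1), q i u * partialThird (F i) (γ u) = 0 := hdelta u hu
  have hg : ∑ i ∈ Finset.range (n + 1), q i u * partialThird (partialThird (F i)) (γ u) = 0 :=
    hgamma u hu
  rw [Finset.sum_congr rfl hsplit, Finset.sum_add_distrib, Finset.sum_sub_distrib,
    ← Finset.mul_sum, ← Finset.mul_sum, hd, hg, mul_zero, mul_zero, sub_zero, add_zero]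
end
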